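/- arXiv:1804.09887 — 2 statements merged into one kernel-verified Lean document; each statement's English description precedes it below -/
import Mathlib

section
/- Let φ ∈ Φ and ρ > 0. If (x̄, w̄) with ⟨e−w̄, 𝒢(x̄)⟩ = 0 is a local optimal solution of the penalty problem (Pρ), then (x̄, w̄) is a local optimal solution of the MPEC (M), and x̄ is a local optimal solution of the group zero-norm problem (P). -/
open scoped BigOperators
open Classical

noncomputable section

/-- Convexity for extended-real-valued functions on `ℝ`. -/
def ERealConvexOn (φ : ℝ → EReal) : Prop :=
  ∀ x y t : ℝ, 0 ≤ t → t ≤ 1 →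
    φ (t * x + (1 - t) * y) ≤ (t : EReal) * φ x + ((1 - t : ℝ) : EReal) * φ y

/-- The subdifferential of a convex function `φ : ℝ → EReal` at a point `t`. -/
def subdiff (φ : ℝ → EReal) (t : ℝ) : Set ℝ :=
  {g : ℝ | ∀ s : ℝ, φ t + ((g * (s - t) : ℝ) : EReal) ≤ φ s}

/-- The left derivative `φ'₋(t)` of a convex function (the infimum of its subdifferential). -/
def leftDeriv (φ : ℝ → EReal) (t : ℝ) : ℝ := sInf (subdiff φ t)

/-- `φ` belongs to the family `Φ`, with distinguished unique minimizer `tstar` of `φ` on `[0,1]`: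
`φ` is a lower semicontinuous proper convex function, `[0,1] ⊆ int(dom φ)`, `φ(1) = 1`,
and `φ(tstar) = 0`. -/
structure MemPhi (φ : ℝ → EReal) (tstar : ℝ) : Prop where
  lsc : LowerSemicontinuous φ
  convex : ERealConvexOn φ
  proper : ∀ t, φ t ≠ ⊥
  domInt : Set.Icc (0:ℝ) 1 ⊆ interior {t | φ t ≠ ⊤}
  phiOne : φ 1 = 1
  tstarMem : tstar ∈ Set.Icc (0:ℝ) 1
  tstarMin : ∀ t ∈ Set.Icc (0:ℝ) 1, t ≠ tstar → φ tstar < φ t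
  phiTstar : φ tstar = 0

/-- `tbar` is the minimal element of `[tstar, 1)` with `1/(1 - tstar) ∈ ∂φ(tbar)`. -/
def IsTbar (φ : ℝ → EReal) (tstar tbar : ℝ) : Prop :=
  tbar ∈ Set.Ico tstar 1 ∧ (1 / (1 - tstar)) ∈ subdiff φ tbar ∧
    ∀ t ∈ Set.Ico tstar 1, (1 / (1 - tstar)) ∈ subdiff φ t → tbar ≤ t

/-- A partition of `{1,…,p}` into `m` nonempty groups. -/
structure GroupStructure (p m : ℕ) where
  J : Fin m → Finset (Fin p)
  nonem : ∀ i, (J i).Nonempty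
  disj : ∀ i j, i ≠ j → Disjoint (J i) (J j)
  cover : ∀ k : Fin p, ∃ i, k ∈ J i

variable {p m n : ℕ}

/-- The Euclidean norm of the `i`-th block `x_{𝒥ᵢ}` of `x`. -/
def gnorm (G : GroupStructure p m) (x : Fin p → ℝ) (i : Fin m) : ℝ :=
  Real.sqrt (∑ j ∈ G.J i, (x j) ^ 2)

/-- The Euclidean norm of a vector. -/
def enorm' {k : ℕ} (x : Fin k → ℝ) : ℝ := Real.sqrt (∑ j, (x j) ^ 2)

/-- The group support `{i : x_{𝒥ᵢ} ≠ 0}` of `x`. -/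
def gsupp (G : GroupStructure p m) (x : Fin p → ℝ) : Finset (Fin m) :=
  Finset.univ.filter (fun i => ∃ j ∈ G.J i, x j ≠ 0)

/-- The group zero-norm `‖𝒢(x)‖₀` of `x`. -/
def gzero (G : GroupStructure p m) (x : Fin p → ℝ) : ℕ := (gsupp G x).card

/-- `‖𝒢(x)‖_∞`, the largest block norm. -/
def gsup (G : GroupStructure p m) (x : Fin p → ℝ) : ℝ := ⨆ i, gnorm G x i

/-- The box `Ω = {x : ‖x‖_∞ ≤ R}`. -/
def OmegaSet (p : ℕ) (R : ℝ) : Set (Fin p → ℝ) := {x | ∀ j, |x j| ≤ R}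

/-- The least-squares loss `f(x) = (1/(2n))‖Ax - b‖²`. -/
def lsObj (A : Matrix (Fin n) (Fin p) ℝ) (b : Fin n → ℝ) (x : Fin p → ℝ) : ℝ :=
  (1 / (2 * n)) * ∑ i, (A.mulVec x i - b i) ^ 2

/-- The objective of the group zero-norm problem (P). -/
def Pobj (G : GroupStructure p m) (A : Matrix (Fin n) (Fin p) ℝ) (b : Fin n → ℝ)
    (ν : ℝ) (x : Fin p → ℝ) : ℝ :=
  ν * lsObj A b x + (gzero G x : ℝ)

/-- Feasibility for the MPEC (M). -/
def MFeas (G : GroupStructure p m) (R : ℝ) (x : Fin p → ℝ) (w : Fin m → ℝ) : Prop :=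
  x ∈ OmegaSet p R ∧ (∀ i, 0 ≤ w i ∧ w i ≤ 1) ∧ ∑ i, (1 - w i) * gnorm G x i = 0

/-- The objective of the MPEC (M). -/
def Mobj (G : GroupStructure p m) (A : Matrix (Fin n) (Fin p) ℝ) (b : Fin n → ℝ)
    (ν : ℝ) (φ : ℝ → EReal) (x : Fin p → ℝ) (w : Fin m → ℝ) : EReal :=
  ((ν * lsObj A b x : ℝ) : EReal) + ∑ i, φ (w i)

/-- The objective of the penalty problem (Pρ). -/
def PenObj (G : GroupStructure p m) (A : Matrix (Fin n) (Fin p) ℝ) (b : Fin n → ℝ)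
    (ν ρ : ℝ) (φ : ℝ → EReal) (x : Fin p → ℝ) (w : Fin m → ℝ) : EReal :=
  ((ν * lsObj A b x + ρ * ∑ i, (1 - w i) * gnorm G x i : ℝ) : EReal) + ∑ i, φ (w i)

/-- The cone `𝒞(S̄, l)` used in restricted strong convexity. -/
def coneC (G : GroupStructure p m) (tbar : ℝ) (Sb : Finset (Fin m)) (l : ℝ) :
    Set (Fin p → ℝ) :=
  {z | ∃ S : Finset (Fin m), Sb ⊆ S ∧ (S.card : ℝ) ≤ l ∧
    ∑ i ∈ Sᶜ, gnorm G z i ≤ (2 / (1 - tbar)) * ∑ i ∈ S, gnorm G z i}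

/-- `ε̂ = (1/n) Aᵀ ε`. -/
def epsHat (A : Matrix (Fin n) (Fin p) ℝ) (ε : Fin n → ℝ) : Fin p → ℝ :=
  fun j => (1 / (n : ℝ)) * ∑ i, A i j * ε i

/-- The group-wise truncation `x^ρ` of `x` at level `c` (blocks with norm `≤ c` are set to 0). -/
def trunc (G : GroupStructure p m) (c : ℝ) (x : Fin p → ℝ) : Fin p → ℝ :=
  fun j => if ∃ i : Fin m, j ∈ G.J i ∧ c < gnorm G x i then x j else 0

theorem exists_enorm'_lt_of_eventually {k : ℕ} {x : Fin k → ℝ} {P : (Fin k → ℝ) → Prop}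
    (h : ∀ᶠ y in nhds x, P y) : ∃ δ > (0:ℝ), ∀ y, enorm' (y - x) < δ → P y := by
  obtain ⟨δ, hδ, hP⟩ := Metric.eventually_nhds_iff.1 h
  refine ⟨δ, hδ, fun y hy => hP ((dist_pi_lt_iff hδ).2 fun j => lt_of_le_of_lt ?_ hy)⟩
  rw [Real.dist_eq]
  exact Real.abs_le_sqrt (Finset.single_le_sum (f := fun j => ((y - x) j) ^ 2)
    (fun i _ => sq_nonneg _) (Finset.mem_univ j))

theorem continuous_lsObj {p n : ℕ} (A : Matrix (Fin n) (Fin p) ℝ) (b : Fin n → ℝ) :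
    Continuous (lsObj A b) := by
  unfold lsObj Matrix.mulVec dotProduct
  fun_prop

theorem eventually_gsupp_subset {p m : ℕ} (G : GroupStructure p m) (x : Fin p → ℝ) :
    ∀ᶠ y in nhds x, gsupp G x ⊆ gsupp G y := by
  have h : ∀ᶠ y in nhds x, ∀ j, x j ≠ 0 → y j ≠ 0 := by
    refine Filter.eventually_all.2 fun j => ?_
    by_cases hj : x j = 0
    · simp [hj]
    · filter_upwards [(continuous_apply j).continuousAt.eventually_ne hj] with y hy _ using hy
  filter_upwards [h] with y hy i hi
  simp only [gsupp, Finset.mem_filter, Finset.mem_univ, true_and] at hi ⊢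
  obtain ⟨j, hj, hx⟩ := hi
  exact ⟨j, hj, hy j hx⟩

theorem gnorm_eq_zero_iff {p m : ℕ} (G : GroupStructure p m) (x : Fin p → ℝ) (i : Fin m) :
    gnorm G x i = 0 ↔ i ∉ gsupp G x := by
  rw [gnorm, Real.sqrt_eq_zero (Finset.sum_nonneg fun j _ => sq_nonneg _),
    Finset.sum_eq_zero_iff_of_nonneg fun j _ => sq_nonneg _]
  simp [gsupp]

/-- Complementarity of `w` with `𝒢(x)` depends on `x` only through its group support. -/
theorem sum_one_sub_mul_gnorm_eq_zero_of_gsupp_eq {p m : ℕ} (G : GroupStructure p m)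
    {x y : Fin p → ℝ} {w : Fin m → ℝ} (hw : ∀ i, w i ≤ 1)
    (hx : ∑ i, (1 - w i) * gnorm G x i = 0) (h : gsupp G x = gsupp G y) :
    ∑ i, (1 - w i) * gnorm G y i = 0 := by
  have hnn (i) (_ : i ∈ Finset.univ) : 0 ≤ (1 - w i) * gnorm G x i :=
    mul_nonneg (sub_nonneg.2 (hw i)) (Real.sqrt_nonneg _)
  rw [Finset.sum_eq_zero_iff_of_nonneg hnn] at hx
  refine Finset.sum_eq_zero fun i hi => ?_
  have := hx i hi
  rwa [mul_eq_zero, gnorm_eq_zero_iff, h, ← gnorm_eq_zero_iff, ← mul_eq_zero] at this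

theorem PenObj_eq_Mobj {p m n : ℕ} (G : GroupStructure p m) (A : Matrix (Fin n) (Fin p) ℝ)
    (b : Fin n → ℝ) (ν ρ : ℝ) (φ : ℝ → EReal) {x : Fin p → ℝ} {w : Fin m → ℝ}
    (h : ∑ i, (1 - w i) * gnorm G x i = 0) :
    PenObj G A b ν ρ φ x w = Mobj G A b ν φ x w := by
  rw [PenObj, Mobj, h, mul_zero, add_zero]

theorem MemPhi.exists_sum_eq_coe {φ : ℝ → EReal} {tstar : ℝ} (hφ : MemPhi φ tstar) {m : ℕ}
    {w : Fin m → ℝ} (hw : ∀ i, 0 ≤ w i ∧ w i ≤ 1) : ∃ c : ℝ, ∑ i, φ (w i) = (c : EReal) := by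
  have h (i) : ∃ c : ℝ, φ (w i) = (c : EReal) :=
    ⟨_, (EReal.coe_toReal (interior_subset (hφ.domInt (hw i))) (hφ.proper _)).symm⟩
  choose c hc using h
  exact ⟨∑ i, c i, by
    simp only [hc]
    exact (map_sum (⟨⟨(↑), EReal.coe_zero⟩, EReal.coe_add⟩ : ℝ →+ EReal) c Finset.univ).symm⟩

/-- **Theorem 2.2, first part.** If `(x̄, w̄)` with `⟨e-w̄, 𝒢(x̄)⟩ = 0` is a local
optimal solution of the penalty problem (Pρ), then `(x̄, w̄)` is a local optimal solution of the
MPEC (M) and `x̄` is a local optimal solution of the group zero-norm problem (P). -/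
theorem penalty_local_to_MPEC_local {p m n : ℕ} (G : GroupStructure p m)
    (A : Matrix (Fin n) (Fin p) ℝ) (b : Fin n → ℝ) (ν R : ℝ) (hν : 0 < ν) (hR : 0 < R)
    (φ : ℝ → EReal) (tstar : ℝ) (hφ : MemPhi φ tstar)
    (ρ : ℝ) (hρ : 0 < ρ) (xb : Fin p → ℝ) (wb : Fin m → ℝ)
    (hxb : xb ∈ OmegaSet p R) (hwb : ∀ i, 0 ≤ wb i ∧ wb i ≤ 1)
    (hcomp : ∑ i, (1 - wb i) * gnorm G xb i = 0)
    (hloc : ∃ δ > (0:ℝ), ∀ y w', y ∈ OmegaSet p R → (∀ i, 0 ≤ w' i ∧ w' i ≤ 1) →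
        enorm' (y - xb) < δ → enorm' (w' - wb) < δ →
        PenObj G A b ν ρ φ xb wb ≤ PenObj G A b ν ρ φ y w') :
    (∃ δ > (0:ℝ), ∀ y w', MFeas G R y w' → enorm' (y - xb) < δ → enorm' (w' - wb) < δ →
        Mobj G A b ν φ xb wb ≤ Mobj G A b ν φ y w')
    ∧ (∃ δ > (0:ℝ), ∀ y ∈ OmegaSet p R, enorm' (y - xb) < δ →
        Pobj G A b ν xb ≤ Pobj G A b ν y) := by
  obtain ⟨δ, hδ, hloc⟩ := hloc
  refine ⟨⟨δ, hδ, fun y w' ⟨hy, hw, hc⟩ hyδ hwδ => ?_⟩, ?_⟩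
  · have := hloc y w' hy hw hyδ hwδ
    rwa [PenObj_eq_Mobj G A b ν ρ φ hcomp, PenObj_eq_Mobj G A b ν ρ φ hc] at this
  · have hf : ∀ᶠ y in nhds xb, ν * lsObj A b xb - 1 < ν * lsObj A b y :=
      ((continuous_lsObj A b).const_mul ν).continuousAt.eventually_const_lt (by linarith)
    obtain ⟨η, hη, hP⟩ :=
      exists_enorm'_lt_of_eventually (hf.and (eventually_gsupp_subset G xb))
    refine ⟨min δ η, lt_min hδ hη, fun y hy hyδ => ?_⟩
    obtain ⟨hlt, hsub⟩ := hP y (hyδ.trans_le (min_le_right _ _))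
    unfold Pobj gzero
    rcases hsub.eq_or_ssubset with heq | hss
    · have := hloc y wb hy hwb (hyδ.trans_le (min_le_left _ _)) (by simpa [enorm'] using hδ)
      rw [PenObj_eq_Mobj G A b ν ρ φ hcomp, PenObj_eq_Mobj G A b ν ρ φ
        (sum_one_sub_mul_gnorm_eq_zero_of_gsupp_eq G (fun i => (hwb i).2) hcomp heq)] at this
      obtain ⟨c, hc⟩ := hφ.exists_sum_eq_coe hwb
      rw [Mobj, Mobj, hc, ← EReal.coe_add, ← EReal.coe_add, EReal.coe_le_coe_iff] at this
      rw [heq]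
      linarith
    · have : ((gsupp G xb).card : ℝ) + 1 ≤ (gsupp G y).card := by
        exact_mod_cast Finset.card_lt_card hss
      linarith


end
end

section
/- Consider the GEP-MSCRA iterates (x^k, w^k). Suppose x̄ ∈ Ω, A satisfies the RSC of constant κ > 0 over 𝒞(S̄, 1.5r̄), √3(4−2t̄_φ)(1−t*_φ)/((3−t̄_φ)κ) ≤ ν ≤ (1−t̄_φ)/((3−t̄_φ)‖𝒢(ε̂)‖_∞), and ν(3−t̄_φ)‖𝒢(ε̂)‖_∞/(1−t̄_φ) ≤ ρ ≤ √((3−t̄_φ)κν/(√3(4−2t̄_φ)(1−t*_φ))). Then for every k ≥ 1, with Δ := {i : ‖x̄_{𝒥_i}‖ ≤ 2φ'₋(1)/ρ}: ‖x^k − x̄‖ ≤ √3·√(Σ_{i∈S̄}‖ε̂_{𝒥_i}‖²)/(κ(√3−1)) + (√3 ρ/(κ(√3−1)ν))·√(|Δ ∩ S̄|) + (1/√3)^{k−1}·‖x¹ − x̄‖. -/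
open scoped BigOperators
open Classical

noncomputable section

variable {p m n : ℕ}

theorem MemPhi.ne_top {φ : ℝ → EReal} {tstar : ℝ} (hφ : MemPhi φ tstar) {t : ℝ}
    (ht : t ∈ Set.Icc (0:ℝ) 1) : φ t ≠ ⊤ :=
  interior_subset (hφ.domInt ht)

/-- Every subgradient at `1` is at least the slope of the chord from `tstar` to `1`. -/
theorem MemPhi.one_div_le_of_mem_subdiff {φ : ℝ → EReal} {tstar γ : ℝ} (hφ : MemPhi φ tstar)
    (ht : tstar < 1) (hγ : γ ∈ subdiff φ 1) : 1 / (1 - tstar) ≤ γ := by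
  have h := hγ tstar
  rw [hφ.phiOne, hφ.phiTstar] at h
  have h' : 1 + γ * (tstar - 1) ≤ 0 := by exact_mod_cast h
  rw [div_le_iff₀ (by linarith)]
  linarith

theorem MemPhi.subdiff_one_nonempty {φ : ℝ → EReal} {tstar : ℝ} (hφ : MemPhi φ tstar)
    (ht : tstar < 1) : (subdiff φ 1).Nonempty := by
  obtain ⟨δ, hδ, hball⟩ := Metric.mem_nhds_iff.1
    (mem_interior_iff_mem_nhds.1 (hφ.domInt (Set.right_mem_Icc.2 zero_le_one)))
  have hright : φ (1 + δ / 2) ≠ ⊤ := hball (by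
    rw [Metric.mem_ball, Real.dist_eq, add_sub_cancel_left, abs_of_pos (by linarith)]
    linarith)
  obtain ⟨γ, hlow, hupp⟩ := exists_between_of_forall_le
    (s := {a : ℝ | ∃ t c : ℝ, t < 1 ∧ φ t = c ∧ a = (1 - c) / (1 - t)})
    (t := {a : ℝ | ∃ s d : ℝ, 1 < s ∧ φ s = d ∧ a = (d - 1) / (s - 1)})
    ⟨_, tstar, 0, ht, hφ.phiTstar, rfl⟩
    ⟨_, 1 + δ / 2, (φ (1 + δ / 2)).toReal, by linarith,
      (EReal.coe_toReal hright (hφ.proper _)).symm, rfl⟩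
    (by
      rintro _ ⟨t, c, ht1, htc, rfl⟩ _ ⟨s, d, hs1, hsd, rfl⟩
      have hst : 0 < s - t := by linarith
      have h := hφ.convex t s ((s - 1) / (s - t)) (div_nonneg (by linarith) hst.le)
        ((div_le_one hst).2 (by linarith))
      rw [show (s - 1) / (s - t) * t + (1 - (s - 1) / (s - t)) * s = 1 by
        field_simp; ring, hφ.phiOne, htc, hsd] at h
      have h' : 1 ≤ (s - 1) / (s - t) * c + (1 - (s - 1) / (s - t)) * d := by
        exact_mod_cast h
      rw [show (s - 1) / (s - t) * c + (1 - (s - 1) / (s - t)) * d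
        = ((s - 1) * c + (1 - t) * d) / (s - t) by field_simp; ring, le_div_iff₀ hst] at h'
      rw [div_le_div_iff₀ (by linarith) (by linarith)]
      linarith)
  refine ⟨γ, fun s => ?_⟩
  by_cases hs : φ s = ⊤
  · rw [hs]; exact le_top
  have hsd := (EReal.coe_toReal hs (hφ.proper s)).symm
  set d := (φ s).toReal
  rw [hφ.phiOne, hsd]
  have key : 1 + γ * (s - 1) ≤ d := by
    rcases lt_trichotomy s 1 with h | h | h
    · have := hlow ⟨s, d, h, hsd, rfl⟩
      rw [div_le_iff₀ (by linarith)] at this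
      linarith
    · subst h
      have : d = 1 := by
        have := hφ.phiOne
        rw [hsd] at this
        exact_mod_cast this
      simp [this]
    · have := hupp ⟨s, d, h, hsd, rfl⟩
      rw [le_div_iff₀ (by linarith)] at this
      linarith
  exact_mod_cast key

/-- Monotonicity of the subdifferential, tested against a minimizer of `t ↦ φ t - ρ t g`. -/
theorem MemPhi.sub_mul_sub_nonpos {φ : ℝ → EReal} {tstar γ t w ρ g : ℝ} (hφ : MemPhi φ tstar)
    (ht : t ∈ Set.Icc (0:ℝ) 1) (hw : w ∈ Set.Icc (0:ℝ) 1) (hγ : γ ∈ subdiff φ t)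
    (hmin : φ w + ((ρ * t * g : ℝ) : EReal) ≤ φ t + ((ρ * w * g : ℝ) : EReal)) :
    (γ - ρ * g) * (w - t) ≤ 0 := by
  have h := hγ w
  rw [← EReal.coe_toReal (hφ.ne_top ht) (hφ.proper t),
    ← EReal.coe_toReal (hφ.ne_top hw) (hφ.proper w)] at h hmin
  have h1 : (φ t).toReal + γ * (w - t) ≤ (φ w).toReal := by exact_mod_cast h
  have h2 : (φ w).toReal + ρ * t * g ≤ (φ t).toReal + ρ * w * g := by exact_mod_cast hmin
  linarith

theorem gnorm_nonneg (G : GroupStructure p m) (x : Fin p → ℝ) (i : Fin m) : 0 ≤ gnorm G x i :=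
  Real.sqrt_nonneg _

theorem gnorm_sq (G : GroupStructure p m) (x : Fin p → ℝ) (i : Fin m) :
    gnorm G x i ^ 2 = ∑ j ∈ G.J i, x j ^ 2 :=
  Real.sq_sqrt (Finset.sum_nonneg fun _ _ => sq_nonneg _)

theorem sum_mul_le_gnorm_mul_gnorm (G : GroupStructure p m) (x y : Fin p → ℝ) (i : Fin m) :
    ∑ j ∈ G.J i, x j * y j ≤ gnorm G x i * gnorm G y i :=
  Real.sum_mul_le_sqrt_mul_sqrt _ _ _

theorem gnorm_add_le (G : GroupStructure p m) (x y : Fin p → ℝ) (i : Fin m) :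
    gnorm G (x + y) i ≤ gnorm G x i + gnorm G y i := by
  refine Real.sqrt_le_iff.2 ⟨add_nonneg (gnorm_nonneg ..) (gnorm_nonneg ..), ?_⟩
  have h : ∑ j ∈ G.J i, (x + y) j ^ 2
      = gnorm G x i ^ 2 + 2 * ∑ j ∈ G.J i, x j * y j + gnorm G y i ^ 2 := by
    rw [gnorm_sq, gnorm_sq, Finset.mul_sum, ← Finset.sum_add_distrib, ← Finset.sum_add_distrib]
    exact Finset.sum_congr rfl fun j _ => by simp only [Pi.add_apply]; ring
  rw [h]
  linarith [sum_mul_le_gnorm_mul_gnorm G x y i]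

theorem gnorm_sub_comm (G : GroupStructure p m) (x y : Fin p → ℝ) (i : Fin m) :
    gnorm G (x - y) i = gnorm G (y - x) i := by
  simp only [gnorm, Pi.sub_apply, sub_sq_comm]

theorem gnorm_le_gnorm_add_gnorm_sub (G : GroupStructure p m) (x y : Fin p → ℝ) (i : Fin m) :
    gnorm G y i ≤ gnorm G x i + gnorm G (x - y) i := by
  simpa [gnorm_sub_comm G x y] using gnorm_add_le G x (y - x) i

theorem eq_zero_of_notMem_gsupp {G : GroupStructure p m} {x : Fin p → ℝ} {i : Fin m}
    (hi : i ∉ gsupp G x) : ∀ j ∈ G.J i, x j = 0 := by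
  simpa [gsupp] using hi

theorem gnorm_eq_zero_of_notMem_gsupp {G : GroupStructure p m} {x : Fin p → ℝ} {i : Fin m}
    (hi : i ∉ gsupp G x) : gnorm G x i = 0 := by
  rw [gnorm, Finset.sum_eq_zero fun j hj => by simp [eq_zero_of_notMem_gsupp hi j hj],
    Real.sqrt_zero]

theorem gnorm_sub_of_notMem_gsupp {G : GroupStructure p m} {x y : Fin p → ℝ} {i : Fin m}
    (hi : i ∉ gsupp G y) : gnorm G (x - y) i = gnorm G x i := by
  unfold gnorm
  congr 1
  exact Finset.sum_congr rfl fun j hj => by simp [eq_zero_of_notMem_gsupp hi j hj]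

theorem gnorm_le_gsup (G : GroupStructure p m) (x : Fin p → ℝ) (i : Fin m) :
    gnorm G x i ≤ gsup G x :=
  le_ciSup (Set.finite_range _).bddAbove i

theorem gsup_nonneg (G : GroupStructure p m) (x : Fin p → ℝ) : 0 ≤ gsup G x :=
  Real.iSup_nonneg (gnorm_nonneg G x)

theorem GroupStructure.sum_eq (G : GroupStructure p m) (f : Fin p → ℝ) :
    ∑ j, f j = ∑ i, ∑ j ∈ G.J i, f j := by
  rw [← Finset.sum_biUnion fun i _ j _ hij => G.disj i j hij]
  congr 1
  ext k
  simpa using G.cover k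

theorem enorm'_nonneg {k : ℕ} (x : Fin k → ℝ) : 0 ≤ enorm' x := Real.sqrt_nonneg _

theorem enorm'_sq {k : ℕ} (x : Fin k → ℝ) : enorm' x ^ 2 = ∑ j, x j ^ 2 :=
  Real.sq_sqrt (Finset.sum_nonneg fun _ _ => sq_nonneg _)

theorem sqrt_sum_gnorm_sq_le (G : GroupStructure p m) (x : Fin p → ℝ) (S : Finset (Fin m)) :
    √(∑ i ∈ S, gnorm G x i ^ 2) ≤ enorm' x := by
  refine Real.sqrt_le_sqrt ?_
  rw [G.sum_eq]
  simp only [← gnorm_sq]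
  exact Finset.sum_le_sum_of_subset_of_nonneg (Finset.subset_univ _) fun _ _ _ => sq_nonneg _

theorem sum_mul_gnorm_le (G : GroupStructure p m) (x : Fin p → ℝ) (S : Finset (Fin m))
    (f : Fin m → ℝ) :
    ∑ i ∈ S, f i * gnorm G x i ≤ √(∑ i ∈ S, f i ^ 2) * enorm' x :=
  (Real.sum_mul_le_sqrt_mul_sqrt _ _ _).trans
    (mul_le_mul_of_nonneg_left (sqrt_sum_gnorm_sq_le G x S) (Real.sqrt_nonneg _))

theorem sum_gnorm_le (G : GroupStructure p m) (x : Fin p → ℝ) (S : Finset (Fin m)) :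
    ∑ i ∈ S, gnorm G x i ≤ √(S.card : ℝ) * enorm' x := by
  simpa using sum_mul_gnorm_le G x S fun _ => 1

/-- Expansion of the least-squares loss around the true parameter. -/
theorem lsObj_sub_lsObj (A : Matrix (Fin n) (Fin p) ℝ) (x xbar : Fin p → ℝ) (ε : Fin n → ℝ) :
    lsObj A (A.mulVec xbar + ε) x - lsObj A (A.mulVec xbar + ε) xbar
      = (1 / (2 * n)) * enorm' (A.mulVec (x - xbar)) ^ 2
        - ∑ j, epsHat A ε j * (x - xbar) j := by
  have h : ∑ j, epsHat A ε j * (x - xbar) j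
      = (1 / (n : ℝ)) * ∑ i, ε i * A.mulVec (x - xbar) i := by
    simp only [epsHat, Matrix.mulVec, dotProduct, Finset.mul_sum, Finset.sum_mul]
    rw [Finset.sum_comm]
    exact Finset.sum_congr rfl fun i _ => Finset.sum_congr rfl fun j _ => by ring
  have e : 1 / (n : ℝ) = (1 / (2 * n)) * 2 := by
    rw [one_div, one_div, mul_inv]; ring
  rw [h, e, enorm'_sq, lsObj, lsObj, mul_assoc, ← mul_sub, ← mul_sub, Finset.mul_sum,
    ← Finset.sum_sub_distrib, ← Finset.sum_sub_distrib]
  congr 1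
  refine Finset.sum_congr rfl fun i _ => ?_
  rw [Matrix.mulVec_sub]
  simp only [Pi.add_apply, Pi.sub_apply]
  ring

/-- The error bound obtained by comparing a solution `x` of the weighted group Lasso problem with
the true parameter, when the weights are at most `tbar` outside a set `S` containing its support. -/
theorem mul_enorm'_sq_le (G : GroupStructure p m) (A : Matrix (Fin n) (Fin p) ℝ)
    (x xbar : Fin p → ℝ) (ε : Fin n → ℝ) {tbar κ l e c : ℝ} (ht : tbar < 1)
    (w : Fin m → ℝ) (hw : ∀ i, w i ∈ Set.Icc (0:ℝ) 1) (hc : 0 < c)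
    (he : ∀ i, gnorm G (epsHat A ε) i ≤ e) (hec : (3 - tbar) * e ≤ c * (1 - tbar))
    (hmin : lsObj A (A.mulVec xbar + ε) x + c * ∑ i, (1 - w i) * gnorm G x i ≤
      lsObj A (A.mulVec xbar + ε) xbar + c * ∑ i, (1 - w i) * gnorm G xbar i)
    (hRSC : ∀ z ∈ coneC G tbar (gsupp G xbar) l,
      κ * (enorm' z) ^ 2 ≤ (1 / (2 * n)) * (enorm' (A.mulVec z)) ^ 2)
    (S : Finset (Fin m)) (hS : gsupp G xbar ⊆ S) (hcard : (S.card : ℝ) ≤ l)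
    (hwS : ∀ i ∉ S, w i ≤ tbar) :
    κ * enorm' (x - xbar) ^ 2 ≤ ∑ i ∈ S, (gnorm G (epsHat A ε) i
      + if i ∈ gsupp G xbar then c * (1 - w i) else 0) * gnorm G (x - xbar) i := by
  set z := x - xbar with hz
  set Q := (1 / (2 * (n : ℝ))) * enorm' (A.mulVec z) ^ 2 with hQ
  have hQ0 : 0 ≤ Q := by positivity
  set f : Fin m → ℝ := fun i => gnorm G (epsHat A ε) i +
    (if i ∈ gsupp G xbar then c * (1 - w i) else -(c * (1 - w i))) with hf
  have hbasic : Q ≤ ∑ i, f i * gnorm G z i := by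
    have h1 := lsObj_sub_lsObj A x xbar ε
    rw [G.sum_eq] at h1
    have h2 : ∑ i, ∑ j ∈ G.J i, epsHat A ε j * (x - xbar) j
        ≤ ∑ i, gnorm G (epsHat A ε) i * gnorm G z i :=
      Finset.sum_le_sum fun i _ => sum_mul_le_gnorm_mul_gnorm G _ _ i
    have h3 : ∑ i, gnorm G (epsHat A ε) i * gnorm G z i
        + c * ∑ i, (1 - w i) * gnorm G xbar i - c * ∑ i, (1 - w i) * gnorm G x i
        ≤ ∑ i, f i * gnorm G z i := by
      rw [Finset.mul_sum, Finset.mul_sum, ← Finset.sum_add_distrib, ← Finset.sum_sub_distrib]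
      refine Finset.sum_le_sum fun i _ => ?_
      have hcw : 0 ≤ c * (1 - w i) := mul_nonneg hc.le (by linarith [(hw i).2])
      by_cases hi : i ∈ gsupp G xbar
      · simp only [hf, if_pos hi]
        have := mul_le_mul_of_nonneg_left (gnorm_le_gnorm_add_gnorm_sub G x xbar i) hcw
        rw [← hz] at this
        linarith
      · simp only [hf, if_neg hi]
        rw [hz, gnorm_sub_of_notMem_gsupp hi, gnorm_eq_zero_of_notMem_gsupp hi]
        linarith
    linarith
  rw [← Finset.sum_add_sum_compl S] at hbasic
  have h3t : 0 < 3 - tbar := by linarith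
  have h2t : 0 < 2 - tbar := by linarith
  have h1t : 0 < 1 - tbar := by linarith
  have hoff : ∑ i ∈ Sᶜ, f i * gnorm G z i
      ≤ -(c * (1 - tbar) * (2 - tbar) / (3 - tbar)) * ∑ i ∈ Sᶜ, gnorm G z i := by
    rw [Finset.mul_sum]
    refine Finset.sum_le_sum fun i hi => mul_le_mul_of_nonneg_right ?_ (gnorm_nonneg ..)
    rw [Finset.mem_compl] at hi
    simp only [hf, if_neg fun h => hi (hS h)]
    have h1 := mul_le_mul_of_nonneg_left (hwS i hi) hc.le
    have h2 : e ≤ c * (1 - tbar) / (3 - tbar) := (le_div_iff₀ h3t).2 (by linarith)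
    have h3 : -(c * (1 - tbar) * (2 - tbar) / (3 - tbar))
        = c * (1 - tbar) / (3 - tbar) - c * (1 - tbar) := by field_simp; ring
    linarith [he i]
  have hon : ∑ i ∈ S, f i * gnorm G z i
      ≤ (c * (2 * (2 - tbar)) / (3 - tbar)) * ∑ i ∈ S, gnorm G z i := by
    rw [Finset.mul_sum]
    refine Finset.sum_le_sum fun i hi => mul_le_mul_of_nonneg_right ?_ (gnorm_nonneg ..)
    have h2 : e ≤ c * (1 - tbar) / (3 - tbar) := (le_div_iff₀ h3t).2 (by linarith)
    have h3 : c * (2 * (2 - tbar)) / (3 - tbar) = c * (1 - tbar) / (3 - tbar) + c := by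
      field_simp; ring
    have h4 : 0 ≤ c * w i := mul_nonneg hc.le (hw i).1
    have h5 : 0 ≤ c * (1 - w i) := mul_nonneg hc.le (by linarith [(hw i).2])
    simp only [hf]
    split_ifs <;> linarith [he i]
  have hoff0 : 0 ≤ ∑ i ∈ Sᶜ, gnorm G z i := Finset.sum_nonneg fun _ _ => gnorm_nonneg ..
  have hcone : z ∈ coneC G tbar (gsupp G xbar) l := by
    refine ⟨S, hS, hcard, ?_⟩
    have hd : 0 < c * (2 - tbar) / (3 - tbar) := by positivity
    have h : c * (2 - tbar) / (3 - tbar) * ((1 - tbar) * ∑ i ∈ Sᶜ, gnorm G z i)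
        ≤ c * (2 - tbar) / (3 - tbar) * (2 * ∑ i ∈ S, gnorm G z i) := by
      have e1 : c * (1 - tbar) * (2 - tbar) / (3 - tbar) * ∑ i ∈ Sᶜ, gnorm G z i
        = c * (2 - tbar) / (3 - tbar) * ((1 - tbar) * ∑ i ∈ Sᶜ, gnorm G z i) := by ring
      have e2 : c * (2 * (2 - tbar)) / (3 - tbar) * ∑ i ∈ S, gnorm G z i
        = c * (2 - tbar) / (3 - tbar) * (2 * ∑ i ∈ S, gnorm G z i) := by ring
      linarith
    have := le_of_mul_le_mul_left h hd
    rw [div_mul_eq_mul_div, le_div_iff₀ h1t]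
    linarith
  have hneg : 0 ≤ c * (1 - tbar) * (2 - tbar) / (3 - tbar) * ∑ i ∈ Sᶜ, gnorm G z i := by
    positivity
  refine (hRSC z hcone).trans (le_trans (b := ∑ i ∈ S, f i * gnorm G z i) (by linarith) ?_)
  refine Finset.sum_le_sum fun i _ => mul_le_mul_of_nonneg_right ?_ (gnorm_nonneg ..)
  have h5 : 0 ≤ c * (1 - w i) := mul_nonneg hc.le (by linarith [(hw i).2])
  simp only [hf]
  split_ifs <;> linarith

theorem le_of_mul_sq_le_mul {κ a b : ℝ} (ha : 0 ≤ a) (hb : 0 ≤ b) (h : κ * a ^ 2 ≤ b * a) :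
    κ * a ≤ b := by
  rcases ha.eq_or_lt with rfl | ha
  · simpa using hb
  · exact le_of_mul_le_mul_right (by linarith [sq a]) ha

/-- A weight exceeding `tbar` forces the corresponding block norm to be large. -/
theorem MemPhi.one_le_of_tbar_lt {φ : ℝ → EReal} {tstar tbar w ρ g : ℝ} (hφ : MemPhi φ tstar)
    (htbar : IsTbar φ tstar tbar) (hw : w ∈ Set.Icc (0:ℝ) 1)
    (hmin : ∀ t ∈ Set.Icc (0:ℝ) 1,
      φ w + ((ρ * t * g : ℝ) : EReal) ≤ φ t + ((ρ * w * g : ℝ) : EReal))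
    (hlt : tbar < w) : 1 ≤ ρ * (1 - tstar) * g := by
  have ht : tbar ∈ Set.Icc (0:ℝ) 1 := ⟨hφ.tstarMem.1.trans htbar.1.1, htbar.1.2.le⟩
  have h := hφ.sub_mul_sub_nonpos ht hw htbar.2.1 (hmin _ ht)
  have h1 : 0 < 1 - tstar := by linarith [htbar.1.1, htbar.1.2]
  have h2 : 1 / (1 - tstar) ≤ ρ * g := by
    by_contra! hc
    linarith [mul_pos (sub_pos.2 hc) (sub_pos.2 hlt)]
  rw [div_le_iff₀ h1] at h2
  linarith

/-- If the true block norm `g₀` exceeds the threshold, the defect of the weight from `1` is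
controlled by the estimation error `a`. -/
theorem MemPhi.one_sub_weight_le {φ : ℝ → EReal} {tstar w ρ g g₀ a : ℝ} (hφ : MemPhi φ tstar)
    (ht : tstar < 1) (hρ : 0 < ρ) (ha : 0 ≤ a) (hw : w ∈ Set.Icc (0:ℝ) 1)
    (hmin : ∀ t ∈ Set.Icc (0:ℝ) 1,
      φ w + ((ρ * t * g : ℝ) : EReal) ≤ φ t + ((ρ * w * g : ℝ) : EReal))
    (hg : g₀ ≤ g + a) (hlt : 2 * leftDeriv φ 1 / ρ < g₀) :
    1 - w ≤ ρ * (1 - tstar) * a := by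
  have hne := hφ.subdiff_one_nonempty ht
  have h1t : 0 < 1 - tstar := by linarith
  have hL : 1 / (1 - tstar) ≤ leftDeriv φ 1 :=
    le_csInf hne fun γ hγ => hφ.one_div_le_of_mem_subdiff ht hγ
  rw [div_lt_iff₀ hρ] at hlt
  have h1 : (1:ℝ) ∈ Set.Icc (0:ℝ) 1 := Set.right_mem_Icc.2 zero_le_one
  by_cases hc : leftDeriv φ 1 < ρ * g
  · obtain ⟨γ, hγ, hγlt⟩ := exists_lt_of_csInf_lt hne hc
    have h := hφ.sub_mul_sub_nonpos h1 hw hγ (hmin 1 h1)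
    have : 1 - w ≤ 0 := by
      by_contra! hw1
      linarith [mul_pos (sub_pos.2 hγlt) hw1]
    exact this.trans (by positivity)
  · have h2 := mul_le_mul_of_nonneg_right hg hρ.le
    have h3 : 1 / (1 - tstar) ≤ ρ * a := by linarith
    rw [div_le_iff₀ h1t] at h3
    linarith [hw.1]

/-- The number of blocks whose norm is bounded below is controlled by the Euclidean norm. -/
theorem sqrt_card_le_mul_enorm' (G : GroupStructure p m) (z : Fin p → ℝ) (T : Finset (Fin m))
    {c : ℝ} (hc : 0 ≤ c) (hT : ∀ i ∈ T, 1 ≤ c * gnorm G z i) :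
    √(T.card : ℝ) ≤ c * enorm' z := by
  have h : (T.card : ℝ) ≤ c ^ 2 * ∑ i ∈ T, gnorm G z i ^ 2 := by
    rw [Finset.mul_sum, Finset.card_eq_sum_ones, Nat.cast_sum]
    refine Finset.sum_le_sum fun i hi => ?_
    rw [← mul_pow, Nat.cast_one]
    exact one_le_pow₀ (hT i hi)
  calc √(T.card : ℝ) ≤ √(c ^ 2 * ∑ i ∈ T, gnorm G z i ^ 2) := Real.sqrt_le_sqrt h
    _ = c * √(∑ i ∈ T, gnorm G z i ^ 2) := by
      rw [Real.sqrt_mul (sq_nonneg c), Real.sqrt_sq hc]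
    _ ≤ c * enorm' z := mul_le_mul_of_nonneg_left (sqrt_sum_gnorm_sq_le G z T) hc

/-- **Theorem 4.2.** Under the RSC assumption and the stated choices of `ν` and
`ρ`, for every `k ≥ 1` the GEP-MSCRA iterates satisfy
`‖x^k - x̄‖ ≤ √3‖[𝒢(ε̂)]_{S̄}‖/(κ(√3-1)) + (√3ρ/(κ(√3-1)ν))√(∑_{i∈S̄} 𝕀_Δ(i)) +
(1/√3)^{k-1}‖x¹ - x̄‖`, where `Δ = {i : ‖x̄_{𝒥ᵢ}‖ ≤ 2φ'₋(1)/ρ}`. -/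
theorem GEP_MSCRA_decreasing_bound {p m n : ℕ} (G : GroupStructure p m)
    (A : Matrix (Fin n) (Fin p) ℝ) (xbar : Fin p → ℝ) (ε : Fin n → ℝ) (b : Fin n → ℝ)
    (hb : b = A.mulVec xbar + ε) (R : ℝ) (hR : 0 < R) (hxbar : xbar ∈ OmegaSet p R)
    (φ : ℝ → EReal) (tstar tbar : ℝ) (hφ : MemPhi φ tstar) (htbar : IsTbar φ tstar tbar)
    (ν ρ : ℝ) (hν : 0 < ν) (hρ : 0 < ρ)
    -- the GEP-MSCRA iterates
    (x : ℕ → Fin p → ℝ) (w : ℕ → Fin m → ℝ)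
    (hw0 : ∀ i, 0 ≤ w 0 i ∧ w 0 i ≤ tbar)
    (hxk : ∀ k : ℕ, 1 ≤ k → x k ∈ OmegaSet p R ∧ ∀ y ∈ OmegaSet p R,
      lsObj A b (x k) +
          (if k = 1 then ν⁻¹ else ρ / ν) * ∑ i, (1 - w (k - 1) i) * gnorm G (x k) i ≤
        lsObj A b y + (if k = 1 then ν⁻¹ else ρ / ν) * ∑ i, (1 - w (k - 1) i) * gnorm G y i)
    (hwk : ∀ k : ℕ, 1 ≤ k → ∀ i, w k i ∈ Set.Icc (0:ℝ) 1 ∧ ∀ t ∈ Set.Icc (0:ℝ) 1,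
      φ (w k i) + ((ρ * t * gnorm G (x k) i : ℝ) : EReal) ≤
        φ t + ((ρ * w k i * gnorm G (x k) i : ℝ) : EReal))
    -- restricted strong convexity and the parameter choices
    (κ : ℝ) (hκ : 0 < κ)
    (hRSC : ∀ z ∈ coneC G tbar (gsupp G xbar) ((3 / 2 : ℝ) * (gsupp G xbar).card),
      κ * (enorm' z) ^ 2 ≤ (1 / (2 * n)) * (enorm' (A.mulVec z)) ^ 2)
    (hν1 : Real.sqrt 3 * (4 - 2 * tbar) * (1 - tstar) / ((3 - tbar) * κ) ≤ ν)
    (hν2 : ν ≤ (1 - tbar) / ((3 - tbar) * gsup G (epsHat A ε)))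
    (hρ1 : ν * (3 - tbar) * gsup G (epsHat A ε) / (1 - tbar) ≤ ρ)
    (hρ2 : ρ ≤ Real.sqrt ((3 - tbar) * κ * ν /
      (Real.sqrt 3 * (4 - 2 * tbar) * (1 - tstar)))) :
    ∀ k : ℕ, 1 ≤ k →
      enorm' (x k - xbar) ≤
        Real.sqrt 3 * Real.sqrt (∑ i ∈ gsupp G xbar, (gnorm G (epsHat A ε) i) ^ 2) /
            (κ * (Real.sqrt 3 - 1)) +
          Real.sqrt 3 * ρ / (κ * (Real.sqrt 3 - 1) * ν) *
            Real.sqrt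
              ((((gsupp G xbar).filter
                  (fun i => gnorm G xbar i ≤ 2 * leftDeriv φ 1 / ρ)).card : ℝ)) +
          (1 / Real.sqrt 3) ^ (k - 1) * enorm' (x 1 - xbar) := by
  obtain ⟨⟨htt, ht1⟩, -, -⟩ := id htbar
  have hts : tstar < 1 := htt.trans_lt ht1
  have h1t : 0 < 1 - tbar := by linarith
  have h3t : 0 < 3 - tbar := by linarith
  have h1s : 0 < 1 - tstar := by linarith
  have hs3 : 0 < √(3:ℝ) := by positivity
  have hs31 : 0 < √(3:ℝ) - 1 := sub_pos.2 (Real.lt_sqrt_of_sq_lt (by norm_num))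
  subst hb
  set e := gsup G (epsHat A ε) with he
  have he_le : ∀ i, gnorm G (epsHat A ε) i ≤ e := gnorm_le_gsup G _
  have he_pos : 0 < e := by
    refine (gsup_nonneg G _).lt_of_ne fun h => ?_
    rw [← he] at h
    rw [← h, mul_zero, div_zero] at hν2
    linarith
  set c : ℕ → ℝ := fun k => if k = 1 then ν⁻¹ else ρ / ν with hcdef
  have hc_pos : ∀ k, 0 < c k := fun k => by
    simp only [hcdef]; split_ifs <;> positivity
  have hc_noise : ∀ k, (3 - tbar) * e ≤ c k * (1 - tbar) := fun k => by
    rw [le_div_iff₀ (by positivity)] at hν2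
    rw [div_le_iff₀ h1t] at hρ1
    refine le_of_mul_le_mul_left ?_ hν
    simp only [hcdef]
    split_ifs
    · rw [mul_inv_cancel_left₀ hν.ne']
      linarith
    · rw [show ν * (ρ / ν * (1 - tbar)) = ρ * (1 - tbar) by field_simp]
      linarith
  have hc_contr : ∀ k, √3 * (4 - 2 * tbar) * (1 - tstar) * (ρ * c k) ≤ (3 - tbar) * κ := by
    have hD : 0 < √3 * (4 - 2 * tbar) * (1 - tstar) :=
      mul_pos (mul_pos hs3 (by linarith)) h1s
    set D := √3 * (4 - 2 * tbar) * (1 - tstar)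
    have hDN : D ≤ (3 - tbar) * κ * ν := by
      rw [div_le_iff₀ (by positivity)] at hν1
      linarith
    have hρD : ρ ^ 2 * D ≤ (3 - tbar) * κ * ν := by
      rw [Real.le_sqrt hρ.le (by positivity), le_div_iff₀ hD] at hρ2
      exact hρ2
    have hρD1 : ρ * D ≤ (3 - tbar) * κ * ν := by
      refine le_of_sq_le_sq ?_ (by positivity)
      nlinarith [mul_le_mul hρD hDN hD.le (by positivity)]
    intro k
    refine le_of_mul_le_mul_right ?_ hν
    simp only [hcdef]
    split_ifs
    · rw [show D * (ρ * ν⁻¹) * ν = ρ * D by field_simp]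
      exact hρD1
    · rw [show D * (ρ * (ρ / ν)) * ν = ρ ^ 2 * D by field_simp]
      exact hρD
  have hw : ∀ k i, w k i ∈ Set.Icc (0:ℝ) 1 := fun k i => by
    rcases Nat.eq_zero_or_pos k with rfl | hk
    · exact ⟨(hw0 i).1, (hw0 i).2.trans ht1.le⟩
    · exact (hwk k hk i).1
  set T : ℕ → Finset (Fin m) := fun k =>
    Finset.univ.filter fun i => i ∉ gsupp G xbar ∧ tbar < w k i with hT
  have hdisj : ∀ k, Disjoint (gsupp G xbar) (T k) := fun k =>
    Finset.disjoint_left.2 fun i hi hi' => (Finset.mem_filter.1 hi').2.1 hi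
  have hTlarge : ∀ k, 1 ≤ k → ∀ i ∈ T k, 1 ≤ ρ * (1 - tstar) * gnorm G (x k - xbar) i := by
    intro k hk i hi
    obtain ⟨-, hi, hlt⟩ := Finset.mem_filter.1 hi
    rw [gnorm_sub_of_notMem_gsupp hi]
    exact hφ.one_le_of_tbar_lt htbar (hw k i) (hwk k hk i).2 hlt
  have hstep : ∀ k, ((T k).card : ℝ) ≤ (gsupp G xbar).card / 2 →
      κ * enorm' (x (k + 1) - xbar) ^ 2 ≤ ∑ i ∈ gsupp G xbar ∪ T k,
        (gnorm G (epsHat A ε) i + if i ∈ gsupp G xbar then c (k + 1) * (1 - w k i) else 0)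
          * gnorm G (x (k + 1) - xbar) i := by
    intro k hk
    refine mul_enorm'_sq_le G A (x (k + 1)) xbar ε ht1 (w k) (hw k) (hc_pos _) he_le
      (hc_noise _) ((hxk (k + 1) k.succ_pos).2 xbar hxbar) hRSC _ Finset.subset_union_left ?_ ?_
    · rw [Finset.card_union_of_disjoint (hdisj k), Nat.cast_add]
      linarith
    · intro i hi
      simp only [hT, Finset.mem_union, Finset.mem_filter, Finset.mem_univ, true_and, not_or,
        not_and, not_lt] at hi
      exact hi.2 hi.1
  have hcard : ∀ k, ((T k).card : ℝ) ≤ (gsupp G xbar).card / 2 := by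
    intro k
    induction k with
    | zero =>
      have : T 0 = ∅ := Finset.filter_eq_empty_iff.2 fun i _ h => (hw0 i).2.not_gt h.2
      rw [this, Finset.card_empty, Nat.cast_zero]
      positivity
    | succ k ih =>
      set S := gsupp G xbar ∪ T k with hS
      set z := x (k + 1) - xbar with hz
      have hScard : (S.card : ℝ) ≤ 3 / 2 * (gsupp G xbar).card := by
        rw [hS, Finset.card_union_of_disjoint (hdisj k), Nat.cast_add]
        linarith
      have hcrude : (3 - tbar) * κ * enorm' z
          ≤ c (k + 1) * (4 - 2 * tbar) * √(S.card : ℝ) := by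
        have hsum : κ * enorm' z ^ 2 ≤ (e + c (k + 1)) * (√(S.card : ℝ) * enorm' z) := by
          refine (hstep k ih).trans (le_trans ?_ (mul_le_mul_of_nonneg_left (sum_gnorm_le G z S)
            (add_pos he_pos (hc_pos _)).le))
          rw [Finset.mul_sum]
          refine Finset.sum_le_sum fun i _ => mul_le_mul_of_nonneg_right ?_ (gnorm_nonneg ..)
          have h4 : 0 ≤ c (k + 1) * w k i := mul_nonneg (hc_pos _).le (hw k i).1
          split_ifs <;> linarith [he_le i, hc_pos (k + 1)]
        have h := le_of_mul_sq_le_mul (enorm'_nonneg z)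
          (mul_nonneg (add_pos he_pos (hc_pos _)).le (Real.sqrt_nonneg _))
          (hsum.trans_eq (mul_assoc _ _ _).symm)
        have h' := mul_le_mul_of_nonneg_left h h3t.le
        have h'' := mul_le_mul_of_nonneg_right (hc_noise (k + 1)) (Real.sqrt_nonneg (S.card : ℝ))
        linarith
      have hTz := sqrt_card_le_mul_enorm' G z (T (k + 1)) (by positivity)
        (hTlarge (k + 1) k.succ_pos)
      have hfin : √3 * √((T (k + 1)).card : ℝ) ≤ √(S.card : ℝ) := by
        refine le_of_mul_le_mul_left ?_ (mul_pos h3t hκ)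
        calc (3 - tbar) * κ * (√3 * √((T (k + 1)).card : ℝ))
            ≤ (3 - tbar) * κ * (√3 * (ρ * (1 - tstar) * enorm' z)) := by gcongr
          _ = √3 * (ρ * (1 - tstar)) * ((3 - tbar) * κ * enorm' z) := by ring
          _ ≤ √3 * (ρ * (1 - tstar)) * (c (k + 1) * (4 - 2 * tbar) * √(S.card : ℝ)) := by
            gcongr
          _ = √3 * (4 - 2 * tbar) * (1 - tstar) * (ρ * c (k + 1)) * √(S.card : ℝ) := by ring
          _ ≤ (3 - tbar) * κ * √(S.card : ℝ) :=
            mul_le_mul_of_nonneg_right (hc_contr _) (Real.sqrt_nonneg _)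
      rw [← Real.sqrt_mul (by norm_num)] at hfin
      have := (Real.sqrt_le_sqrt_iff (Nat.cast_nonneg _)).1 hfin
      linarith
  set E := √(∑ i ∈ gsupp G xbar, gnorm G (epsHat A ε) i ^ 2) with hE
  set N := √(((gsupp G xbar).filter
    fun i => gnorm G xbar i ≤ 2 * leftDeriv φ 1 / ρ).card : ℝ) with hN
  have hrec : ∀ k, 1 ≤ k → κ * enorm' (x (k + 1) - xbar)
      ≤ E + ρ / ν * N + κ / √3 * enorm' (x k - xbar) := by
    intro k hk
    have hck : c (k + 1) = ρ / ν := if_neg (by omega)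
    set z := x (k + 1) - xbar
    set y := x k - xbar with hy
    have hq : 0 < ρ / ν := by positivity
    have hcoef : ρ / ν * (ρ * (1 - tstar)) ≤ κ / √3 := by
      rw [le_div_iff₀ hs3]
      refine le_of_mul_le_mul_left ?_ h3t
      have h := hc_contr (k + 1)
      rw [hck] at h
      have : 0 ≤ √3 * (1 - tstar) * (ρ * (ρ / ν)) * (1 - tbar) := by positivity
      linarith
    have hS := hstep k (hcard k)
    rw [Finset.sum_union (hdisj k), hck] at hS
    have hsupp : ∑ i ∈ gsupp G xbar, (gnorm G (epsHat A ε) i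
          + if i ∈ gsupp G xbar then ρ / ν * (1 - w k i) else 0) * gnorm G z i
        ≤ E * enorm' z + ρ / ν * (N * enorm' z)
          + ρ / ν * (ρ * (1 - tstar)) * ∑ i ∈ gsupp G xbar, gnorm G y i * gnorm G z i := by
      refine le_trans ?_ (add_le_add_left (add_le_add
        (sum_mul_gnorm_le G z (gsupp G xbar) (gnorm G (epsHat A ε)))
        (mul_le_mul_of_nonneg_left (sum_gnorm_le G z _) hq.le)) _)
      rw [Finset.sum_filter, Finset.mul_sum, Finset.mul_sum, ← Finset.sum_add_distrib,
        ← Finset.sum_add_distrib]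
      refine Finset.sum_le_sum fun i hi => ?_
      rw [if_pos hi]
      have hz0 := gnorm_nonneg G z i
      have hy0 := gnorm_nonneg G y i
      split_ifs with hΔ
      · have h1 : 0 ≤ ρ / ν * w k i * gnorm G z i :=
          mul_nonneg (mul_nonneg hq.le (hw k i).1) hz0
        have h2 : 0 ≤ ρ / ν * (ρ * (1 - tstar)) * (gnorm G y i * gnorm G z i) := by positivity
        linarith
      · have h := hφ.one_sub_weight_le hts hρ hy0 (hw k i) (hwk k hk i).2
          (gnorm_le_gnorm_add_gnorm_sub G (x k) xbar i) (not_le.1 hΔ)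
        have := mul_le_mul_of_nonneg_right (mul_le_mul_of_nonneg_left h hq.le) hz0
        linarith
    have hextra : ∑ i ∈ T k, (gnorm G (epsHat A ε) i
          + if i ∈ gsupp G xbar then ρ / ν * (1 - w k i) else 0) * gnorm G z i
        ≤ ρ / ν * (ρ * (1 - tstar)) * ∑ i ∈ T k, gnorm G y i * gnorm G z i := by
      rw [Finset.mul_sum]
      refine Finset.sum_le_sum fun i hi => ?_
      rw [if_neg (Finset.mem_filter.1 hi).2.1, add_zero, ← mul_assoc]
      refine mul_le_mul_of_nonneg_right ?_ (gnorm_nonneg ..)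
      have h1 := mul_le_mul_of_nonneg_left (hTlarge k hk i hi) hq.le
      have h2 : e ≤ ρ / ν := by
        have := hc_noise (k + 1)
        rw [hck] at this
        nlinarith
      linarith [he_le i]
    have hcross : ∑ i ∈ gsupp G xbar ∪ T k, gnorm G y i * gnorm G z i
        ≤ enorm' y * enorm' z :=
      (sum_mul_gnorm_le G z _ _).trans
        (mul_le_mul_of_nonneg_right (sqrt_sum_gnorm_sq_le G y _) (enorm'_nonneg z))
    rw [Finset.sum_union (hdisj k)] at hcross
    have hz0 := enorm'_nonneg z
    have hy0 := enorm'_nonneg y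
    refine le_of_mul_sq_le_mul hz0 (by positivity) ?_
    have h1 := mul_le_mul_of_nonneg_left hcross
      (by positivity : 0 ≤ ρ / ν * (ρ * (1 - tstar)))
    have h2 := mul_le_mul_of_nonneg_right hcoef (mul_nonneg hy0 hz0)
    linarith
  intro k hk
  induction k, hk using Nat.le_induction with
  | base =>
    rw [Nat.sub_self, pow_zero, one_mul]
    exact le_add_of_nonneg_left (by positivity)
  | succ k hk ih =>
    obtain ⟨k, rfl⟩ : ∃ j, k = j + 1 := ⟨k - 1, by omega⟩
    rw [Nat.add_sub_cancel] at ih ⊢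
    have h := (hrec _ hk).trans (add_le_add_right
      (mul_le_mul_of_nonneg_left ih (by positivity : 0 ≤ κ / √3)) _)
    refine le_of_mul_le_mul_left (h.trans_eq ?_) hκ
    have hs1 : √(3:ℝ) - 1 ≠ 0 := hs31.ne'
    rw [pow_succ]
    field_simp
    ring

end
end
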